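/- arXiv:1309.5082 — 3 statements merged into one kernel-verified Lean document; each statement's English description precedes it below -/
import Mathlib

section
/- Let R = k[x_0,…,x_n] be a polynomial ring over a field k, let 𝔪 = (x_0,…,x_n), and let I ⊆ R be a monomial ideal with big-height e. Let σ(I) be the minimum number of variables in the support of a monomial in I (i.e., the minimum, over monomials f ∈ I, of the number of distinct variables dividing f). Then for every integer r ≥ 1, I^{(r+e)} ⊆ 𝔪^{σ(I)} · I^{(r)}. -/
open MvPolynomial Pointwise

noncomputable section

/-- The contraction to `R` of the extension of `I ^ m` to the localization of `R` at the
prime ideal `P`, i.e. `R ∩ I^m R_P`. -/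
def contractedPower {R : Type*} [CommRing R] (I : Ideal R) (m : ℕ)
    (P : Ideal R) (hP : P.IsPrime) : Ideal R :=
  letI := hP
  (Ideal.map (algebraMap R (Localization.AtPrime P)) (I ^ m)).comap
    (algebraMap R (Localization.AtPrime P))

/-- `Q_{⊆ P} = R ∩ I R_P`, the contraction to `R` of the extension of `I` to `R_P`. -/
def Qsub {R : Type*} [CommRing R] (I P : Ideal R) (hP : P.IsPrime) : Ideal R :=
  letI := hP
  (Ideal.map (algebraMap R (Localization.AtPrime P)) I).comap
    (algebraMap R (Localization.AtPrime P))

/-- The `m`-th symbolic power `I^{(m)} = ⋂_{P ∈ Ass(I)} (R ∩ I^m R_P)`. -/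
def symbolicPower {R : Type*} [CommRing R] (I : Ideal R) (m : ℕ) : Ideal R :=
  ⨅ P : {P : Ideal R // P ∈ associatedPrimes R (R ⧸ I)},
    contractedPower I m P.1 P.2.isPrime

/-- The set of associated primes of `I` that are maximal with respect to inclusion. -/
def maxAss {R : Type*} [CommRing R] (I : Ideal R) : Set (Ideal R) :=
  {P | P ∈ associatedPrimes R (R ⧸ I) ∧
    ∀ P' ∈ associatedPrimes R (R ⧸ I), P ≤ P' → P = P'}

/-- A monomial ideal: an ideal generated by monomials. -/
def IsMonomialIdeal {k : Type*} [Field k] {n : ℕ}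
    (I : Ideal (MvPolynomial (Fin (n + 1)) k)) : Prop :=
  ∃ S : Set (Fin (n + 1) →₀ ℕ),
    I = Ideal.span ((fun a => (monomial a (1 : k) : MvPolynomial (Fin (n + 1)) k)) '' S)

/-- A square-free monomial ideal: an ideal generated by square-free monomials. -/
def IsSquarefreeMonomialIdeal {k : Type*} [Field k] {n : ℕ}
    (I : Ideal (MvPolynomial (Fin (n + 1)) k)) : Prop :=
  ∃ S : Set (Fin (n + 1) →₀ ℕ), (∀ a ∈ S, ∀ i, a i ≤ 1) ∧
    I = Ideal.span ((fun a => (monomial a (1 : k) : MvPolynomial (Fin (n + 1)) k)) '' S)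

/-- The height of a prime ideal. -/
def primeHeight {R : Type*} [CommRing R] (P : Ideal R) (hP : P.IsPrime) : ℕ∞ :=
  Order.height (⟨P, hP⟩ : PrimeSpectrum R)

/-- `e` is the big-height of `I`: the maximum of the heights of the associated primes of `I`. -/
def IsBigHeight {R : Type*} [CommRing R] (I : Ideal R) (e : ℕ) : Prop :=
  (∀ P, ∀ h : P ∈ associatedPrimes R (R ⧸ I), primeHeight P h.isPrime ≤ (e : ℕ∞)) ∧
    ∃ P, ∃ h : P ∈ associatedPrimes R (R ⧸ I), primeHeight P h.isPrime = (e : ℕ∞)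

/-- The irrelevant maximal ideal `𝔪 = (x_0, …, x_n)`. -/
def mId (k : Type*) [Field k] (n : ℕ) : Ideal (MvPolynomial (Fin (n + 1)) k) :=
  Ideal.span (Set.range X)

/-- The exponent vector of a monomial, viewed as a point of `ℝ^{n+1}`. -/
def expVec {n : ℕ} (a : Fin (n + 1) →₀ ℕ) : Fin (n + 1) → ℝ := fun i => (a i : ℝ)

/-- `L(J)`: the set of exponent vectors of the monomials lying in `J`. -/
def latticePoints {k : Type*} [Field k] {n : ℕ}
    (J : Ideal (MvPolynomial (Fin (n + 1)) k)) : Set (Fin (n + 1) → ℝ) :=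
  {v | ∃ a : Fin (n + 1) →₀ ℕ, monomial a (1 : k) ∈ J ∧ v = expVec a}

/-- The exponent vectors of the minimal monomial generators of a monomial ideal. -/
def minGens {k : Type*} [Field k] {n : ℕ}
    (J : Ideal (MvPolynomial (Fin (n + 1)) k)) : Set (Fin (n + 1) →₀ ℕ) :=
  {a | monomial a (1 : k) ∈ J ∧
    ∀ b : Fin (n + 1) →₀ ℕ, monomial b (1 : k) ∈ J → b ≤ a → b = a}

/-- The symbolic polyhedron `𝒬 = ⋂_{P ∈ maxAss(I)} conv(L(Q_{⊆P}))`. -/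
def symbolicPolyhedron {k : Type*} [Field k] {n : ℕ}
    (I : Ideal (MvPolynomial (Fin (n + 1)) k)) : Set (Fin (n + 1) → ℝ) :=
  ⋂ P : {P : Ideal (MvPolynomial (Fin (n + 1)) k) // P ∈ maxAss I},
    convexHull ℝ (latticePoints (Qsub I P.1 P.2.1.isPrime))

/-- `α(J)`: the least degree of a nonzero (homogeneous) element of `J`. -/
def alphaI {k : Type*} [Field k] {n : ℕ}
    (J : Ideal (MvPolynomial (Fin (n + 1)) k)) : ℕ :=
  sInf {d | ∃ f ∈ J, f ≠ 0 ∧ MvPolynomial.IsHomogeneous f d}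

/-- `β(J)`: the largest degree of a minimal generator of the monomial ideal `J`. -/
def betaI {k : Type*} [Field k] {n : ℕ}
    (J : Ideal (MvPolynomial (Fin (n + 1)) k)) : ℕ :=
  sSup {d | ∃ a ∈ minGens J, ∑ i, a i = d}

/-- `α(𝒫) = inf { a_0 + ⋯ + a_n : a ∈ 𝒫 }` for a subset `𝒫 ⊆ ℝ^{n+1}`. -/
def alphaSet {n : ℕ} (P : Set (Fin (n + 1) → ℝ)) : ℝ :=
  sInf ((fun v => ∑ i, v i) '' P)

/-- The set of all conical (nonnegative) combinations of elements of `S`. -/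
def conicalHull {E : Type*} [AddCommMonoid E] [Module ℝ E] (S : Set E) : Set E :=
  {x | ∃ (t : Finset E) (c : E → ℝ), ↑t ⊆ S ∧ (∀ y, 0 ≤ c y) ∧ x = ∑ y ∈ t, c y • y}

/-- The staircase of a monomial ideal `J`. -/
def stairs {k : Type*} [Field k] {n : ℕ}
    (J : Ideal (MvPolynomial (Fin (n + 1)) k)) : Set (Fin (n + 1) → ℝ) :=
  {v | (∀ i, 0 ≤ v i) ∧
    ∃ a : Fin (n + 1) →₀ ℕ, monomial a (1 : k) ∈ J ∧ ∀ i, (a i : ℝ) ≤ v i}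

end

namespace MonomialSymbolicPower

variable {σ : Type*} {k : Type*} [Field k]

/-- The ideal generated by the monomials with exponent vectors in `S`. -/
noncomputable def monomialIdeal (k : Type*) [Field k] (S : Set (σ →₀ ℕ)) : Ideal (MvPolynomial σ k) :=
  Ideal.span ((fun a => monomial a (1 : k)) '' S)

theorem mem_monomialIdeal_iff {S : Set (σ →₀ ℕ)} {f : MvPolynomial σ k} :
    f ∈ monomialIdeal k S ↔ ∀ a ∈ f.support, ∃ b ∈ S, b ≤ a :=
  mem_ideal_span_monomial_image

theorem monomial_mem_monomialIdeal_iff {S : Set (σ →₀ ℕ)} {a : σ →₀ ℕ} :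
    monomial a (1 : k) ∈ monomialIdeal k S ↔ ∃ b ∈ S, b ≤ a := by
  classical
  rw [mem_monomialIdeal_iff, support_monomial, if_neg one_ne_zero]
  simp

/-- The set of sums of `m` elements of `S`. -/
def sumset {M : Type*} [AddCommMonoid M] (S : Set M) : ℕ → Set M
  | 0 => {0}
  | m + 1 => sumset S m + S

theorem monomialIdeal_pow (S : Set (σ →₀ ℕ)) (m : ℕ) :
    monomialIdeal k S ^ m = monomialIdeal k (sumset S m) := by
  induction m with
  | zero =>
    rw [pow_zero, Ideal.one_eq_top, eq_comm, Ideal.eq_top_iff_one]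
    exact monomial_mem_monomialIdeal_iff.2 ⟨0, rfl, le_rfl⟩
  | succ m ih =>
    rw [pow_succ, ih, monomialIdeal, monomialIdeal, monomialIdeal, Ideal.span_mul_span']
    congr 1
    ext f
    simp only [sumset, Set.mem_mul, Set.mem_image, Set.mem_add]
    constructor
    · rintro ⟨_, ⟨a, ha, rfl⟩, _, ⟨b, hb, rfl⟩, rfl⟩
      exact ⟨a + b, ⟨a, ha, b, hb, rfl⟩, by simp [monomial_mul]⟩
    · rintro ⟨_, ⟨a, ha, b, hb, rfl⟩, rfl⟩
      exact ⟨_, ⟨a, ha, rfl⟩, _, ⟨b, hb, rfl⟩, by simp [monomial_mul]⟩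

theorem apply_eq_zero_of_mem_sumset {S : Set (σ →₀ ℕ)} {i : σ} (h : ∀ a ∈ S, a i = 0) {m : ℕ} :
    ∀ a ∈ sumset S m, a i = 0 := by
  induction m with
  | zero => rintro _ rfl; rfl
  | succ m ih =>
    rintro _ ⟨a, ha, b, hb, rfl⟩
    simp [ih a ha, h b hb]

theorem exists_mem_sumset_le_tsub_single {S : Set (σ →₀ ℕ)} (i : σ) {m : ℕ} :
    ∀ a ∈ sumset S (m + 1), ∃ b ∈ sumset S m, b ≤ a - Finsupp.single i 1 := by
  classical
  induction m with
  | zero => exact fun a _ => ⟨0, rfl, zero_le⟩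
  | succ m ih =>
    rintro _ ⟨a, ha, b, hb, rfl⟩
    by_cases hbi : b i = 0
    · obtain ⟨c, hc, hca⟩ := ih a ha
      refine ⟨c + b, ⟨c, hc, b, hb, rfl⟩, fun j => ?_⟩
      have := hca j
      by_cases hj : i = j
      · subst hj
        simp_all
      · simp_all
    · refine ⟨a, ha, fun j => ?_⟩
      by_cases hj : i = j
      · subst hj
        simp
        omega
      · simp [hj]

theorem exists_mem_sumset_le_tsub_indicator {S : Set (σ →₀ ℕ)} (V : Finset σ) {m : ℕ}
    {a : σ →₀ ℕ} (ha : a ∈ sumset S (m + V.card)) :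
    ∃ b ∈ sumset S m, ∀ i, b i ≤ a i ∧ (i ∈ V → b i ≤ a i - 1) := by
  classical
  induction V using Finset.induction_on generalizing m with
  | empty => exact ⟨a, by simpa using ha, by simp⟩
  | insert j V hj ih =>
    rw [Finset.card_insert_of_notMem hj, ← add_assoc, add_right_comm] at ha
    obtain ⟨b, hb, hba⟩ := ih ha
    obtain ⟨c, hc, hcb⟩ := exists_mem_sumset_le_tsub_single j b hb
    refine ⟨c, hc, fun i => ?_⟩
    have h1 := hba i
    have h2 := hcb i
    rw [Finsupp.tsub_apply] at h2
    refine ⟨by omega, fun hi => ?_⟩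
    rcases Finset.mem_insert.1 hi with rfl | hi
    · rw [Finsupp.single_eq_same] at h2
      omega
    · have := h1.2 hi
      omega

/-- A polynomial outside the prime ideal `(X i : i ∈ V)` is a nonzerodivisor modulo any monomial
ideal whose generators only involve the variables in `V`. -/
theorem mem_of_mul_mem_monomialIdeal {V : Set σ} {S : Set (σ →₀ ℕ)}
    (hS : ∀ a ∈ S, ∀ i ∉ V, a i = 0) {u f : MvPolynomial σ k}
    (hu : u ∉ Ideal.span (X '' V : Set (MvPolynomial σ k)))
    (huf : u * f ∈ monomialIdeal k S) : f ∈ monomialIdeal k S := by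
  classical
  by_contra hf
  let f' : MvPolynomial σ k := ∑ a ∈ f.support with ¬ ∃ b ∈ S, b ≤ a, monomial a (f.coeff a)
  have hcoeff (a) : f'.coeff a = if ∃ b ∈ S, b ≤ a then 0 else f.coeff a := by
    simp only [f', coeff_sum, coeff_monomial, Finset.sum_ite_eq', Finset.mem_filter,
      mem_support_iff]
    by_cases h1 : ∃ b ∈ S, b ≤ a <;> by_cases h2 : f.coeff a = 0 <;> simp [h1, h2]
  have hsupp (a) (ha : f'.coeff a ≠ 0) : ¬ ∃ b ∈ S, b ≤ a := by
    intro h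
    exact ha (by rw [hcoeff, if_pos h])
  have hsub : f - f' ∈ monomialIdeal k S := by
    rw [mem_monomialIdeal_iff]
    intro a ha
    by_contra h
    rw [mem_support_iff, coeff_sub, hcoeff, if_neg h, sub_self] at ha
    exact ha rfl
  have huf' : u * f' ∈ monomialIdeal k S := by
    have := sub_mem huf (Ideal.mul_mem_left _ u hsub)
    rwa [mul_sub, sub_sub_cancel] at this
  have hf'0 : f'.support.Nonempty := by
    rw [Finset.nonempty_iff_ne_empty, Ne, support_eq_empty]
    intro h
    rw [h, sub_zero] at hsub
    exact hf hsub
  let deg : (σ →₀ ℕ) → ℕ := fun a => (a.filter (· ∈ V)).degree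
  have deg_add (a b) : deg (a + b) = deg a + deg b := by
    simp only [deg, Finsupp.filter_add, map_add]
  obtain ⟨m, hm, hmin⟩ := Finset.exists_min_image f'.support deg hf'0
  let A := u.support.filter fun a => deg a = 0
  let B := f'.support.filter fun b => deg b = deg m
  have deg_zero (a) : deg a = 0 ↔ ∀ i ∈ V, a i = 0 := by
    simp only [deg, Finsupp.degree_eq_zero_iff, Finsupp.filter_eq_zero_iff]
  have hA : A.Nonempty := by
    rw [mem_ideal_span_X_image] at hu
    push Not at hu
    obtain ⟨a, ha, h⟩ := hu
    exact ⟨a, Finset.mem_filter.2 ⟨ha, (deg_zero a).2 h⟩⟩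
  have hB : B.Nonempty := ⟨m, Finset.mem_filter.2 ⟨hm, rfl⟩⟩
  obtain ⟨a, ha, b, hb, hab⟩ := UniqueSums.uniqueAdd_of_nonempty hA hB
  obtain ⟨ha, ha0⟩ := Finset.mem_filter.1 ha
  obtain ⟨hb, hb0⟩ := Finset.mem_filter.1 hb
  have hc : (u * f').coeff (a + b) = u.coeff a * f'.coeff b := by
    rw [coeff_mul, Finset.sum_eq_single (a, b)]
    · rintro ⟨c, d⟩ hcd hne
      rw [Finset.HasAntidiagonal.mem_antidiagonal] at hcd
      by_contra h
      have hcu : c ∈ u.support := mem_support_iff.2 (left_ne_zero_of_mul h)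
      have hdf : d ∈ f'.support := mem_support_iff.2 (right_ne_zero_of_mul h)
      have h1 := hmin d hdf
      have h2 : deg c + deg d = deg a + deg b := by
        rw [← deg_add, ← deg_add]
        exact congrArg deg hcd
      have h3 := hab (a := c) (b := d) (Finset.mem_filter.2 ⟨hcu, by omega⟩)
        (Finset.mem_filter.2 ⟨hdf, by omega⟩) hcd
      exact hne (Prod.ext h3.1 h3.2)
    · intro h
      exact (h (by rw [Finset.HasAntidiagonal.mem_antidiagonal])).elim
  have hne : (u * f').coeff (a + b) ≠ 0 := by
    rw [hc]
    exact mul_ne_zero (mem_support_iff.1 ha) (mem_support_iff.1 hb)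
  obtain ⟨c, hcS, hcab⟩ := mem_monomialIdeal_iff.1 huf' _ (mem_support_iff.2 hne)
  refine hsupp b (mem_support_iff.1 hb) ⟨c, hcS, fun i => ?_⟩
  by_cases hi : i ∈ V
  · have h1 := hcab i
    rwa [Finsupp.add_apply, (deg_zero a).1 ha0 i hi, zero_add] at h1
  · rw [hS c hcS i hi]
    exact Nat.zero_le _

theorem span_X_eq_monomialIdeal (V : Set σ) :
    Ideal.span (X '' V : Set (MvPolynomial σ k)) =
      monomialIdeal k ((fun i => Finsupp.single i 1) '' V) := by
  rw [monomialIdeal, Set.image_image]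
  rfl

theorem isPrime_span_X (V : Set σ) : (Ideal.span (X '' V : Set (MvPolynomial σ k))).IsPrime := by
  classical
  refine ⟨?_, fun {u f} huf => or_iff_not_imp_left.2 fun hu => ?_⟩
  · rw [Ideal.ne_top_iff_one, mem_ideal_span_X_image]
    simp
  · rw [span_X_eq_monomialIdeal] at huf ⊢
    refine mem_of_mul_mem_monomialIdeal (V := V) ?_ hu huf
    rintro _ ⟨j, hj, rfl⟩ i hi
    exact Finsupp.single_eq_of_ne fun h => hi (h ▸ hj)

theorem card_le_height_span_X (V : Finset σ) :
    (V.card : ℕ∞) ≤ primeHeight (Ideal.span (X '' (V : Set σ) : Set (MvPolynomial σ k)))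
      (isPrime_span_X _) := by
  classical
  induction V using Finset.induction_on with
  | empty => simp
  | insert j V hj ih =>
    rw [Finset.card_insert_of_notMem hj, Nat.cast_add, Nat.cast_one]
    refine (add_le_add_left ih 1).trans (Order.height_add_one_le ?_)
    refine lt_of_le_not_ge (Ideal.span_mono (Set.image_mono (by simp))) fun h => ?_
    have hX : (X j : MvPolynomial σ k) ∈ Ideal.span (X '' (V : Set σ)) :=
      h (Ideal.subset_span ⟨j, by simp, rfl⟩)
    rw [mem_ideal_span_X_image] at hX
    obtain ⟨i, hi, hij⟩ := hX (Finsupp.single j 1) (by simp [support_X])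
    rcases eq_or_ne i j with rfl | h
    · exact hj hi
    · exact hij (Finsupp.single_eq_of_ne h)

theorem card_le_primeHeight {P : Ideal (MvPolynomial σ k)} (hP : P.IsPrime) {V : Finset σ}
    (hV : ∀ i ∈ V, X i ∈ P) : (V.card : ℕ∞) ≤ primeHeight P hP := by
  refine (card_le_height_span_X (k := k) V).trans (Order.height_mono ?_)
  change Ideal.span _ ≤ P
  rw [Ideal.span_le]
  rintro _ ⟨i, hi, rfl⟩
  exact hV i hi

theorem mem_contractedPower_iff {R : Type*} [CommRing R] {I P : Ideal R} {hP : P.IsPrime} {m : ℕ}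
    {f : R} : f ∈ contractedPower I m P hP ↔ ∃ u ∉ P, u * f ∈ I ^ m := by
  rw [contractedPower, Ideal.mem_comap,
    IsLocalization.algebraMap_mem_map_algebraMap_iff P.primeCompl]
  rfl

theorem contractedPower_anti {R : Type*} [CommRing R] {I P : Ideal R} {hP : P.IsPrime} {m m' : ℕ}
    (h : m ≤ m') : contractedPower I m' P hP ≤ contractedPower I m P hP := by
  intro f hf
  rw [mem_contractedPower_iff] at hf ⊢
  obtain ⟨u, hu, huf⟩ := hf
  exact ⟨u, hu, Ideal.pow_le_pow_right h huf⟩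

theorem symbolicPower_le_self {R : Type*} [CommRing R] [IsNoetherianRing R] (I : Ideal R) {m : ℕ}
    (hm : 1 ≤ m) : symbolicPower I m ≤ I := by
  intro f hf
  by_contra hfI
  obtain ⟨P, hP, hle⟩ := exists_le_isAssociatedPrime_of_isNoetherianRing R
    (Ideal.Quotient.mk I f) (by rwa [Ne, Ideal.Quotient.eq_zero_iff_mem])
  rw [symbolicPower, Ideal.mem_iInf] at hf
  obtain ⟨u, hu, huf⟩ := mem_contractedPower_iff.1 (contractedPower_anti hm (hf ⟨P, hP⟩))
  rw [pow_one] at huf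
  refine hu (hle ?_)
  rw [Submodule.mem_colon_singleton, Submodule.mem_bot, Algebra.smul_def]
  exact Ideal.Quotient.eq_zero_iff_mem.2 huf

open Classical in
/-- The contraction of `I ^ m R_P` for a monomial ideal `I` is obtained by setting the variables
outside `P` equal to `1` in the generators of `I`. -/
theorem contractedPower_monomialIdeal (S : Set (σ →₀ ℕ)) {P : Ideal (MvPolynomial σ k)}
    (hP : P.IsPrime) (m : ℕ) :
    contractedPower (monomialIdeal k S) m P hP =
      monomialIdeal k (sumset (Finsupp.filter (fun i => (X i : MvPolynomial σ k) ∈ P) '' S) m) := by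
  let p : σ → Prop := fun i => (X i : MvPolynomial σ k) ∈ P
  have hsplit (a : σ →₀ ℕ) : (monomial a (1 : k)) =
      monomial (a.filter fun i => ¬ p i) 1 * monomial (a.filter p) 1 := by
    rw [monomial_mul, one_mul, add_comm, Finsupp.filter_add_filter_not]
  apply le_antisymm
  · intro f hf
    obtain ⟨u, hu, huf⟩ := mem_contractedPower_iff.1 hf
    refine mem_of_mul_mem_monomialIdeal (V := {i | p i}) (u := u) ?_ (fun h => hu ?_) ?_
    · intro a ha i hi
      refine apply_eq_zero_of_mem_sumset (i := i) ?_ a ha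
      rintro _ ⟨b, -, rfl⟩
      exact Finsupp.filter_apply_neg _ _ hi
    · refine (Ideal.span_le.2 ?_ : Ideal.span _ ≤ P) h
      rintro _ ⟨i, hi, rfl⟩
      exact hi
    · rw [← monomialIdeal_pow]
      refine Ideal.pow_right_mono ?_ m huf
      refine Ideal.span_le.2 ?_
      rintro _ ⟨a, ha, rfl⟩
      change monomial a 1 ∈ _
      rw [hsplit]
      exact Ideal.mul_mem_left _ _ (Ideal.subset_span ⟨_, ⟨a, ha, rfl⟩, rfl⟩)
  · rw [← monomialIdeal_pow, contractedPower, ← Ideal.map_le_iff_le_comap, Ideal.map_pow,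
      Ideal.map_pow]
    refine Ideal.pow_right_mono ?_ m
    rw [Ideal.map_le_iff_le_comap]
    refine Ideal.span_le.2 ?_
    rintro _ ⟨_, ⟨a, ha, rfl⟩, rfl⟩
    rw [SetLike.mem_coe, Ideal.mem_comap,
      IsLocalization.algebraMap_mem_map_algebraMap_iff P.primeCompl]
    refine ⟨monomial (a.filter fun i => ¬ p i) 1, fun h => ?_, ?_⟩
    · rw [SetLike.mem_coe, monomial_eq, C_1, one_mul, Finsupp.prod, hP.prod_mem_iff] at h
      obtain ⟨i, hi, hiP⟩ := h
      rw [Finsupp.support_filter, Finset.mem_filter] at hi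
      exact hi.2 (hP.mem_of_pow_mem _ hiP)
    · rw [← hsplit]
      exact Ideal.subset_span ⟨a, ha, rfl⟩

theorem symbolicPower_monomialIdeal_support [Finite σ] {S : Set (σ →₀ ℕ)} {e : ℕ}
    (he : ∀ P, ∀ h : P ∈ associatedPrimes (MvPolynomial σ k) (MvPolynomial σ k ⧸ monomialIdeal k S),
      primeHeight P h.isPrime ≤ e) {r : ℕ} {f : MvPolynomial σ k}
    (hf : f ∈ symbolicPower (monomialIdeal k S) (r + e)) {a : σ →₀ ℕ} (ha : a ∈ f.support) :
    monomial (a.mapRange (· - 1) rfl) (1 : k) ∈ symbolicPower (monomialIdeal k S) r := by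
  classical
  have := Fintype.ofFinite σ
  rw [symbolicPower, Ideal.mem_iInf] at hf ⊢
  rintro ⟨P, hP⟩
  have hfP := hf ⟨P, hP⟩
  let V : Finset σ := {i | (X i : MvPolynomial σ k) ∈ P}
  have hV : V.card ≤ e := by
    exact_mod_cast (card_le_primeHeight hP.isPrime (V := V) (by simp [V])).trans (he P hP)
  have hfP' := contractedPower_anti (show r + V.card ≤ r + e by omega) hfP
  rw [contractedPower_monomialIdeal] at hfP' ⊢
  obtain ⟨b, hb, hba⟩ := mem_monomialIdeal_iff.1 hfP' a ha
  obtain ⟨c, hc, hcb⟩ := exists_mem_sumset_le_tsub_indicator V hb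
  refine monomial_mem_monomialIdeal_iff.2 ⟨c, hc, fun i => ?_⟩
  rw [Finsupp.mapRange_apply]
  by_cases hi : i ∈ V
  · have h1 := (hcb i).2 hi
    have h2 := hba i
    omega
  · rw [apply_eq_zero_of_mem_sumset (i := i) ?_ c hc]
    · exact Nat.zero_le _
    · rintro _ ⟨d, -, rfl⟩
      exact Finsupp.filter_apply_neg _ _ (by simpa [V] using hi)

end MonomialSymbolicPower

theorem symbolic_power_add_bigheight_subset {k : Type*} [Field k] {n : ℕ}
    (I : Ideal (MvPolynomial (Fin (n + 1)) k)) (hmon : IsMonomialIdeal I)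
    (e : ℕ) (he : IsBigHeight I e) (s : ℕ)
    (hs : IsLeast {d | ∃ a : Fin (n + 1) →₀ ℕ,
      monomial a (1 : k) ∈ I ∧ a.support.card = d} s)
    (r : ℕ) (hr : 1 ≤ r) :
    symbolicPower I (r + e) ≤ mId k n ^ s * symbolicPower I r := by
  classical
  obtain ⟨S, rfl⟩ := hmon
  intro f hf
  rw [f.as_sum]
  refine Ideal.sum_mem _ fun a ha => ?_
  have hI : monomial a (1 : k) ∈ MonomialSymbolicPower.monomialIdeal k S :=
    MonomialSymbolicPower.monomial_mem_monomialIdeal_iff.2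
      (MonomialSymbolicPower.mem_monomialIdeal_iff.1
        (MonomialSymbolicPower.symbolicPower_le_self _ (by omega) hf) a ha)
  have hcard : s ≤ a.support.card := hs.2 ⟨a, hI, rfl⟩
  have hsplit : monomial a (f.coeff a) =
      monomial (a.mapRange (min 1) rfl) (f.coeff a) *
        monomial (a.mapRange (· - 1) rfl) (1 : k) := by
    rw [monomial_mul, mul_one]
    refine congrArg (fun b => monomial b (f.coeff a)) (Finsupp.ext fun i => ?_)
    simp only [Finsupp.add_apply, Finsupp.mapRange_apply]
    omega
  rw [hsplit]
  refine Ideal.mul_mem_mul ?_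
    (MonomialSymbolicPower.symbolicPower_monomialIdeal_support he.1 hf ha)
  refine (monomial_mem_pow_idealOfVars_iff s _ (mem_support_iff.1 ha)).2 (hcard.trans ?_)
  rw [Finsupp.degree_eq_sum, Finset.card_eq_sum_ones, ← Finset.sum_subset a.support.subset_univ]
  · refine Finset.sum_le_sum fun i hi => ?_
    rw [Finsupp.mem_support_iff] at hi
    rw [Finsupp.mapRange_apply]
    omega
  · intro i _ hi
    rw [Finsupp.mapRange_apply, Finsupp.notMem_support_iff.1 hi]
    rfl
end

section
/- For n ≥ 2, the monomial ideal I = (xy², yz², zx², xyz) = (x²,y) ∩ (y²,z) ∩ (z²,x) in R = k[x,y,z] does not satisfy the containment I^{(3)} ⊆ 𝔪 I², where 𝔪 = (x,y,z): specifically, the monomial x²y²z² lies in I^{(3)} = (x²,y)³ ∩ (y²,z)³ ∩ (z²,x)³ but not in 𝔪 I². -/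
open MvPolynomial Pointwise

/-- A set of monomials cut out by a condition on two of the three exponents that is stable under
increasing them is saturated with respect to multiplication by polynomials having a term which is
a power of the third variable. -/
theorem forall_mem_support_of_mul {k : Type*} [Field k] (T : ℕ → ℕ → Prop)
    (hT : ∀ a b a' b', a ≤ a' → b ≤ b' → T a b → T a' b') (c : Fin 3)
    {s g : MvPolynomial (Fin 3) k} (hs : ∃ e ∈ s.support, e c = 0 ∧ e (c + 1) = 0)
    (hsg : ∀ e ∈ (s * g).support, T (e c) (e (c + 1))) :
    ∀ e ∈ g.support, T (e c) (e (c + 1)) := by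
  classical
  have hcover : ∀ c t : Fin 3, t = c ∨ t = c + 1 ∨ t = c + 2 := by decide
  by_contra! hcon
  obtain ⟨u, hu, humin⟩ := Finset.exists_min_image
    (s.support.filter fun e => e c = 0 ∧ e (c + 1) = 0) (fun e => e (c + 2))
    (by obtain ⟨e, he, h⟩ := hs; exact ⟨e, Finset.mem_filter.2 ⟨he, h⟩⟩)
  obtain ⟨v, hv, hvmin⟩ := Finset.exists_min_image
    (g.support.filter fun e => ¬ T (e c) (e (c + 1)))
    (fun e => toLex (e c + e (c + 1), e (c + 2)))
    (by obtain ⟨e, he, h⟩ := hcon; exact ⟨e, Finset.mem_filter.2 ⟨he, h⟩⟩)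
  simp only [Finset.mem_filter] at hu hv humin hvmin
  obtain ⟨hus, hu0, hu1⟩ := hu
  obtain ⟨hvg, hvT⟩ := hv
  have hcoeff : coeff (u + v) (s * g) = coeff u s * coeff v g := by
    rw [coeff_mul]
    refine Finset.sum_eq_single (u, v) ?_ (fun h => absurd (by simp) h)
    rintro ⟨u', v'⟩ hmem hne
    by_contra hprod
    have hu' : u' ∈ s.support := mem_support_iff.2 (left_ne_zero_of_mul hprod)
    have hv' : v' ∈ g.support := mem_support_iff.2 (right_ne_zero_of_mul hprod)
    have hsum : ∀ t, u' t + v' t = u t + v t := fun t => by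
      simpa using DFunLike.congr_fun (Finset.HasAntidiagonal.mem_antidiagonal.1 hmem) t
    have h0 := hsum c
    have h1 := hsum (c + 1)
    have h2 := hsum (c + 2)
    have hle := hvmin v'
      ⟨hv', fun h => hvT (hT _ _ _ _ (by omega) (by omega) h)⟩
    rw [Prod.Lex.toLex_le_toLex] at hle
    simp only at hle
    have hu'min := humin u' ⟨hu', by omega, by omega⟩
    refine hne (Prod.ext (Finsupp.ext fun t => ?_) (Finsupp.ext fun t => ?_)) <;>
      rcases hcover c t with rfl | rfl | rfl <;> simp only <;> omega
  have hmem : u + v ∈ (s * g).support := by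
    rw [mem_support_iff, hcoeff]
    exact mul_ne_zero (mem_support_iff.1 hus) (mem_support_iff.1 hvg)
  have := hsg _ hmem
  simp only [Finsupp.add_apply, hu0, hu1, zero_add] at this
  exact hvT this

theorem mem_span_X_pair {k σ : Type*} [Field k] {i j : σ} {f : MvPolynomial σ k} :
    f ∈ Ideal.span {X i, X j} ↔ ∀ e ∈ f.support, e i ≠ 0 ∨ e j ≠ 0 := by
  rw [← Set.image_pair, mem_ideal_span_X_image]
  simp

/-- Membership in a power of `(X i ^ 2, X j)`, monomial by monomial. -/
theorem mem_span_sq_pair_pow {k σ : Type*} [Field k] {i j : σ} (hij : i ≠ j) {m : ℕ}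
    {f : MvPolynomial σ k} :
    f ∈ Ideal.span {X i ^ 2, X j} ^ m ↔ ∀ e ∈ f.support, m ≤ e i / 2 + e j := by
  classical
  have key : ∀ {m : ℕ} {f : MvPolynomial σ k},
      f ∈ Ideal.span ((fun e => monomial e (1 : k)) '' {e | m ≤ e i / 2 + e j}) ↔
        ∀ e ∈ f.support, m ≤ e i / 2 + e j := by
    intro m f
    rw [mem_ideal_span_monomial_image]
    refine forall₂_congr fun e _ => ⟨?_, fun h => ⟨e, h, le_rfl⟩⟩
    rintro ⟨d, hd, hde⟩
    have h1 := hde i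
    have h2 := hde j
    simp only [Set.mem_ofPred_eq] at hd
    omega
  constructor
  · rw [← key]
    suffices h : Ideal.span {X i ^ 2, X j} ^ m ≤
        Ideal.span ((fun e => monomial e (1 : k)) '' {e | m ≤ e i / 2 + e j}) from fun hf => h hf
    induction m with
    | zero => exact fun f _ => key.2 fun e _ => Nat.zero_le _
    | succ m ih =>
      rw [pow_succ]
      refine (Ideal.mul_mono_left ih).trans ?_
      rw [Ideal.span_mul_span', Ideal.span_le]
      rintro _ ⟨_, ⟨e, he, rfl⟩, _, hq, rfl⟩
      simp only [Set.mem_ofPred_eq] at he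
      rcases hq with rfl | rfl
      · refine Ideal.subset_span ⟨e + Finsupp.single i 2, ?_, ?_⟩
        · simp [hij]
          omega
        · simp [X_pow_eq_monomial, monomial_mul]
      · refine Ideal.subset_span ⟨e + Finsupp.single j 1, ?_, ?_⟩
        · simp [hij.symm]
          omega
        · simp [X, monomial_mul]
  · rw [← key]
    suffices h : Ideal.span ((fun e => monomial e (1 : k)) '' {e | m ≤ e i / 2 + e j}) ≤
        Ideal.span {X i ^ 2, X j} ^ m from fun hf => h hf
    rw [Ideal.span_le]
    rintro _ ⟨e, he, rfl⟩
    have hmem : ((X i : MvPolynomial σ k) ^ 2) ^ (e i / 2) * X j ^ (e j) ∈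
        Ideal.span {X i ^ 2, X j} ^ (e i / 2 + e j) := by
      rw [pow_add]
      exact Ideal.mul_mem_mul (Ideal.pow_mem_pow (Ideal.subset_span (by simp)) _)
        (Ideal.pow_mem_pow (Ideal.subset_span (by simp)) _)
    refine Ideal.pow_le_pow_right he (Ideal.mem_of_dvd _ ?_ hmem)
    rw [← pow_mul, X_pow_eq_monomial, X_pow_eq_monomial, monomial_mul, monomial_dvd_monomial]
    refine ⟨Or.inr fun t => ?_, by simp⟩
    by_cases hti : t = i
    · subst hti
      simp [hij]
      omega
    · by_cases htj : t = j
      · subst htj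
        simp [hij]
      · simp [Ne.symm hti, Ne.symm htj]

theorem mem_associatedPrimes_quotient_iff {R : Type*} [CommRing R] [IsNoetherianRing R]
    {I P : Ideal R} :
    P ∈ associatedPrimes R (R ⧸ I) ↔ P.IsPrime ∧ ∃ f, ∀ g, g ∈ P ↔ g * f ∈ I := by
  rw [AssociatedPrimes.mem_iff, IsAssociatedPrime, Submodule.isAssociatedPrime_iff,
    Ideal.Quotient.mk_surjective.exists]
  refine and_congr_right fun _ => exists_congr fun f => ?_
  rw [SetLike.ext_iff]
  refine forall_congr' fun g => ?_
  rw [Submodule.mem_colon_singleton, Submodule.mem_bot, ← Ideal.Quotient.eq_zero_iff_mem (I := I)]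
  rfl

theorem mem_contractedPower_iff {R : Type*} [CommRing R] {I P : Ideal R} {m : ℕ}
    {hP : P.IsPrime} {g : R} :
    g ∈ contractedPower I m P hP ↔ ∃ s ∉ P, s * g ∈ I ^ m := by
  let := hP
  rw [contractedPower, Ideal.mem_comap,
    IsLocalization.algebraMap_mem_map_algebraMap_iff P.primeCompl]
  rfl

/-- The `m`-th symbolic power of an intersection of `P i`-primary ideals `Q i` whose `m`-th powers
are `P i`-primary too, and which agrees with `Q i` locally at `P i`, is the intersection of the
`m`-th powers of the `Q i`. -/
theorem symbolicPower_iInf {R ι : Type*} [CommRing R] [IsNoetherianRing R] [Fintype ι]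
    {Q P : ι → Ideal R} {m : ℕ}
    (hass : ∀ i, P i ∈ associatedPrimes R (R ⧸ ⨅ i, Q i))
    (hrad : ∀ i, P i ≤ (Q i).radical)
    (hprim : ∀ i, ∀ a ∉ P i, ∀ g, a * g ∈ Q i → g ∈ Q i)
    (hprim_pow : ∀ i, ∀ a ∉ P i, ∀ g, a * g ∈ Q i ^ m → g ∈ Q i ^ m)
    (hloc : ∀ i, ∃ s ∉ P i, ∀ q ∈ Q i, s * q ∈ ⨅ i, Q i) :
    symbolicPower (⨅ i, Q i) m = ⨅ i, Q i ^ m := by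
  have hassoc : ∀ p ∈ associatedPrimes R (R ⧸ ⨅ i, Q i), ∃ i, p = P i := by
    intro p hp
    obtain ⟨hp, f, hf⟩ := mem_associatedPrimes_quotient_iff.1 hp
    have hle : (Finset.univ.inf fun i => (Q i).colon {f}) ≤ p := by
      intro g hg
      rw [hf, Ideal.mem_iInf]
      intro i
      exact Submodule.mem_colon_singleton.1 ((Finset.inf_le (Finset.mem_univ i) :
        (Finset.univ.inf fun i => (Q i).colon {f}) ≤ _) hg)
    obtain ⟨i, -, hi⟩ := (Ideal.IsPrime.inf_le' hp).1 hle
    have hfi : f ∉ Q i := fun h =>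
      hp.ne_top ((Ideal.eq_top_iff_one _).2
        (hi (Submodule.mem_colon_singleton.2 (by simpa using h))))
    refine ⟨i, le_antisymm (fun g hg => ?_) ?_⟩
    · by_contra hgi
      exact hfi (hprim i g hgi f ((Ideal.mem_iInf.1 ((hf g).1 hg)) i))
    · refine (hrad i).trans (hp.radical_le_iff.2 fun q hq => hi ?_)
      exact Submodule.mem_colon_singleton.2 ((Q i).mul_mem_right f hq)
  have hcontr : ∀ i, ∀ hP : (P i).IsPrime, contractedPower (⨅ i, Q i) m (P i) hP = Q i ^ m := by
    intro i hP
    ext g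
    rw [mem_contractedPower_iff]
    constructor
    · rintro ⟨s, hs, hsg⟩
      exact hprim_pow i s hs g (Ideal.pow_right_mono (iInf_le Q i) m hsg)
    · intro hg
      obtain ⟨s, hs, hsq⟩ := hloc i
      refine ⟨s ^ m, fun h => hs (hP.mem_of_pow_mem m h), ?_⟩
      have hle : Ideal.span {s} * Q i ≤ ⨅ i, Q i := by
        rw [Ideal.span_singleton_mul_le_iff]
        exact hsq
      refine Ideal.pow_right_mono hle m ?_
      rw [mul_pow]
      exact Ideal.mul_mem_mul (Ideal.pow_mem_pow (Ideal.mem_span_singleton_self s) m) hg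
  refine le_antisymm (le_iInf fun i => ?_) (le_iInf ?_)
  · rw [← hcontr i (hass i).isPrime]
    exact iInf_le (fun p : {p // p ∈ associatedPrimes R (R ⧸ ⨅ i, Q i)} =>
      contractedPower (⨅ i, Q i) m p.1 p.2.isPrime) ⟨P i, hass i⟩
  · rintro ⟨p, hp⟩
    obtain ⟨i, rfl⟩ := hassoc p hp
    rw [hcontr i hp.isPrime]
    exact iInf_le _ i

theorem mem_span_sq_pair_pow_of_mul_mem {k : Type*} [Field k] (c : Fin 3) {m : ℕ}
    {a g : MvPolynomial (Fin 3) k} (ha : a ∉ Ideal.span {X c, X (c + 1)})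
    (hag : a * g ∈ Ideal.span {X c ^ 2, X (c + 1)} ^ m) :
    g ∈ Ideal.span {X c ^ 2, X (c + 1)} ^ m := by
  have hc : c ≠ c + 1 := (by decide : ∀ c : Fin 3, c ≠ c + 1) c
  rw [mem_span_sq_pair_pow hc] at hag ⊢
  rw [mem_span_X_pair] at ha
  push Not at ha
  exact forall_mem_support_of_mul (fun a b => m ≤ a / 2 + b) (fun _ _ _ _ _ _ _ => by omega) c
    ha hag

theorem isPrime_span_X_pair {k : Type*} [Field k] (c : Fin 3) :
    (Ideal.span {X c, X (c + 1)} : Ideal (MvPolynomial (Fin 3) k)).IsPrime := by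
  refine ⟨fun h => ?_, fun {a b} hab => or_iff_not_imp_left.2 fun ha => ?_⟩
  · have := mem_span_X_pair.1 ((Ideal.eq_top_iff_one _).1 h) 0 (by simp)
    simp at this
  · rw [mem_span_X_pair] at ha hab ⊢
    push Not at ha
    exact forall_mem_support_of_mul (fun a b => a ≠ 0 ∨ b ≠ 0)
      (fun _ _ _ _ _ _ _ => by omega) c ha hab

theorem span_eq_iInf_span_sq_pair {k : Type*} [Field k] :
    (Ideal.span {X 0 * X 1 ^ 2, X 1 * X 2 ^ 2, X 2 * X 0 ^ 2, X 0 * X 1 * X 2} :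
      Ideal (MvPolynomial (Fin 3) k)) = ⨅ c : Fin 3, Ideal.span {X c ^ 2, X (c + 1)} := by
  have hne : ∀ c : Fin 3, c ≠ c + 1 := by decide
  have hgen : ({X 0 * X 1 ^ 2, X 1 * X 2 ^ 2, X 2 * X 0 ^ 2, X 0 * X 1 * X 2} :
      Set (MvPolynomial (Fin 3) k)) = (fun e => monomial e (1 : k)) ''
        {Finsupp.single 0 1 + Finsupp.single 1 2, Finsupp.single 1 1 + Finsupp.single 2 2,
          Finsupp.single 2 1 + Finsupp.single 0 2,
          Finsupp.single 0 1 + Finsupp.single 1 1 + Finsupp.single 2 1} := by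
    simp only [Set.image_insert_eq, Set.image_singleton, X_pow_eq_monomial]
    simp only [X, monomial_mul, mul_one]
  ext f
  rw [hgen, mem_ideal_span_monomial_image, Ideal.mem_iInf]
  have hQ := fun c : Fin 3 => mem_span_sq_pair_pow (hne c) (m := 1) (f := f)
  simp only [pow_one] at hQ
  simp only [hQ]
  rw [forall_comm]
  refine forall_congr' fun e => ?_
  rw [forall_comm]
  refine forall_congr' fun _ => ?_
  simp [Fin.forall_fin_succ, Finsupp.le_def]
  omega

theorem symbolicPower_iInf_span_sq_pair {k : Type*} [Field k] (m : ℕ) :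
    symbolicPower (⨅ c : Fin 3, Ideal.span {X c ^ 2, X (c + 1)} :
      Ideal (MvPolynomial (Fin 3) k)) m = ⨅ c : Fin 3, Ideal.span {X c ^ 2, X (c + 1)} ^ m := by
  have hne : ∀ c : Fin 3, c ≠ c + 1 := by decide
  have hcover : ∀ c t : Fin 3, t = c ∨ t = c + 1 ∨ t = c + 2 := by decide
  have hadd : ∀ c : Fin 3, c + 1 + 1 = c + 2 ∧ c + 2 + 1 = c := by decide
  have hprim : ∀ (c : Fin 3) (m : ℕ), ∀ a ∉ Ideal.span {X c, X (c + 1)},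
      ∀ g : MvPolynomial (Fin 3) k, a * g ∈ Ideal.span {X c ^ 2, X (c + 1)} ^ m →
        g ∈ Ideal.span {X c ^ 2, X (c + 1)} ^ m :=
    fun c m a ha g hag => mem_span_sq_pair_pow_of_mul_mem c ha hag
  have hX : ∀ c : Fin 3,
      (X (c + 2) ^ 2 : MvPolynomial (Fin 3) k) ∉ Ideal.span {X c, X (c + 1)} := by
    intro c h
    have := mem_span_X_pair.1 h (Finsupp.single (c + 2) 2) (by simp [X_pow_eq_monomial])
    simp at this
  have hsq : ∀ c : Fin 3, (X c ^ 2 : MvPolynomial (Fin 3) k) ∈ Ideal.span {X c ^ 2, X (c + 1)} :=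
    fun c => Ideal.subset_span (by simp)
  have hlin : ∀ c : Fin 3, (X (c + 1) : MvPolynomial (Fin 3) k) ∈
    Ideal.span {X c ^ 2, X (c + 1)} := fun c => Ideal.subset_span (by simp)
  have hmem : ∀ (c : Fin 3) (f : MvPolynomial (Fin 3) k), f ∈ Ideal.span {X c ^ 2, X (c + 1)} →
      f ∈ Ideal.span {X (c + 1) ^ 2, X (c + 2)} → f ∈ Ideal.span {X (c + 2) ^ 2, X c} →
      f ∈ ⨅ c : Fin 3, Ideal.span {X c ^ 2, X (c + 1)} := by
    intro c f h0 h1 h2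
    refine Ideal.mem_iInf.2 fun t => ?_
    rcases hcover c t with rfl | rfl | rfl
    · exact h0
    · rwa [(hadd c).1]
    · rwa [(hadd _).2]
  have hlin1 : ∀ c : Fin 3, (X (c + 2) : MvPolynomial (Fin 3) k) ∈
    Ideal.span {X (c + 1) ^ 2, X (c + 2)} := fun c => Ideal.subset_span (by simp)
  have hlin2 : ∀ c : Fin 3, (X c : MvPolynomial (Fin 3) k) ∈
    Ideal.span {X (c + 2) ^ 2, X c} := fun c => Ideal.subset_span (by simp)
  have hsq2 : ∀ c : Fin 3, (X (c + 2) ^ 2 : MvPolynomial (Fin 3) k) ∈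
    Ideal.span {X (c + 2) ^ 2, X c} := fun c => Ideal.subset_span (by simp)
  have hloc : ∀ c : Fin 3, ∀ q ∈ Ideal.span {X c ^ 2, X (c + 1)},
      (X (c + 2) ^ 2 : MvPolynomial (Fin 3) k) * q ∈
        ⨅ c : Fin 3, Ideal.span {X c ^ 2, X (c + 1)} := fun c q hq =>
    hmem c _ (Ideal.mul_mem_left _ _ hq)
      (Ideal.mul_mem_right _ _ (Ideal.pow_mem_of_mem _ (hlin1 c) 2 two_pos))
      (Ideal.mul_mem_right _ _ (hsq2 c))
  refine symbolicPower_iInf (P := fun c => Ideal.span {X c, X (c + 1)}) (fun c => ?_) (fun c => ?_)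
    (fun c => by simpa using hprim c 1) (fun c => hprim c m)
    (fun c => ⟨X (c + 2) ^ 2, hX c, hloc c⟩)
  · refine mem_associatedPrimes_quotient_iff.2
      ⟨isPrime_span_X_pair c, X c * X (c + 2) ^ 2, fun g => ⟨fun hg => ?_, fun hg => ?_⟩⟩
    · rw [← mul_assoc, mul_comm]
      refine hloc c _ ?_
      have hle : Ideal.span {X c, X (c + 1)} * Ideal.span {X c} ≤
          (Ideal.span {X c ^ 2, X (c + 1)} : Ideal (MvPolynomial (Fin 3) k)) := by
        rw [Ideal.span_mul_span', Ideal.span_le]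
        rintro _ ⟨_, rfl | rfl, _, rfl, rfl⟩
        · simpa [sq] using hsq c
        · exact Ideal.mul_mem_right _ _ (hlin c)
      exact hle (Ideal.mul_mem_mul hg (Ideal.mem_span_singleton_self _))
    · by_contra hgP
      have h1 := hprim c 1 (X (c + 2) ^ 2) (hX c) (g * X c) (by
        rw [pow_one, mul_comm, mul_assoc]
        exact Ideal.mem_iInf.1 hg c)
      have h2 := (mem_span_sq_pair_pow (hne c)).1 (hprim c 1 g hgP _ h1)
        (Finsupp.single c 1) (by simp [X])
      simp at h2
  · rw [Ideal.span_le]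
    rintro _ (rfl | rfl)
    · exact ⟨2, hsq c⟩
    · exact Ideal.le_radical (hlin c)

theorem iInf_fin_three {α : Type*} [CompleteLattice α] (f : Fin 3 → α) :
    ⨅ c, f c = f 0 ⊓ f 1 ⊓ f 2 :=
  le_antisymm (le_inf (le_inf (iInf_le f 0) (iInf_le f 1)) (iInf_le f 2))
    (le_iInf (Fin.forall_fin_succ.2 ⟨inf_le_left.trans inf_le_left, Fin.forall_fin_two.2
      ⟨inf_le_left.trans inf_le_right, inf_le_right⟩⟩))

theorem counterexample_non_squarefree {k : Type*} [Field k] {n : ℕ} (hn : 2 ≤ n) :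
    let x : MvPolynomial (Fin 3) k := X 0
    let y : MvPolynomial (Fin 3) k := X 1
    let z : MvPolynomial (Fin 3) k := X 2
    let I : Ideal (MvPolynomial (Fin 3) k) :=
      Ideal.span {x * y ^ 2, y * z ^ 2, z * x ^ 2, x * y * z}
    let mm : Ideal (MvPolynomial (Fin 3) k) := Ideal.span {x, y, z}
    I = Ideal.span {x ^ 2, y} ⊓ Ideal.span {y ^ 2, z} ⊓ Ideal.span {z ^ 2, x} ∧
    symbolicPower I 3 =
      Ideal.span {x ^ 2, y} ^ 3 ⊓ Ideal.span {y ^ 2, z} ^ 3 ⊓ Ideal.span {z ^ 2, x} ^ 3 ∧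
    x ^ 2 * y ^ 2 * z ^ 2 ∈ symbolicPower I 3 ∧
    x ^ 2 * y ^ 2 * z ^ 2 ∉ mm * I ^ 2 ∧
    ¬ symbolicPower I 3 ≤ mm * I ^ 2 := by
  intro x y z I mm
  have hI : I = ⨅ c : Fin 3, Ideal.span {X c ^ 2, X (c + 1)} := span_eq_iInf_span_sq_pair
  have hI' : I = Ideal.span {x ^ 2, y} ⊓ Ideal.span {y ^ 2, z} ⊓ Ideal.span {z ^ 2, x} := by
    rw [hI, iInf_fin_three]
    rfl
  have hsymb : symbolicPower I 3 =
      Ideal.span {x ^ 2, y} ^ 3 ⊓ Ideal.span {y ^ 2, z} ^ 3 ⊓ Ideal.span {z ^ 2, x} ^ 3 := by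
    rw [hI, symbolicPower_iInf_span_sq_pair, iInf_fin_three]
    rfl
  have hmono : x ^ 2 * y ^ 2 * z ^ 2 =
      monomial (Finsupp.single 0 2 + Finsupp.single 1 2 + Finsupp.single 2 2) (1 : k) := by
    simp only [x, y, z, X_pow_eq_monomial, monomial_mul, mul_one]
  have hmem : x ^ 2 * y ^ 2 * z ^ 2 ∈ symbolicPower I 3 := by
    rw [hI, symbolicPower_iInf_span_sq_pair, Ideal.mem_iInf, hmono]
    intro c
    rw [mem_span_sq_pair_pow (by revert c; decide)]
    fin_cases c <;> simp
  have hnot : x ^ 2 * y ^ 2 * z ^ 2 ∉ mm * I ^ 2 := by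
    intro h
    have hX : ∀ i : Fin 3, X i ∈ idealOfVars (Fin 3) k := fun i =>
      Ideal.subset_span (Set.mem_range_self i)
    have hmm : mm ≤ idealOfVars (Fin 3) k := by
      rw [Ideal.span_le]
      rintro _ (rfl | rfl | rfl) <;> exact hX _
    have hI3 : I ≤ idealOfVars (Fin 3) k ^ 3 := by
      rw [Ideal.span_le]
      rintro _ (rfl | rfl | rfl | rfl)
      · rw [SetLike.mem_coe, pow_succ']
        exact Ideal.mul_mem_mul (hX _) (Ideal.pow_mem_pow (hX _) 2)
      · rw [SetLike.mem_coe, pow_succ']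
        exact Ideal.mul_mem_mul (hX _) (Ideal.pow_mem_pow (hX _) 2)
      · rw [SetLike.mem_coe, pow_succ']
        exact Ideal.mul_mem_mul (hX _) (Ideal.pow_mem_pow (hX _) 2)
      · rw [SetLike.mem_coe, pow_succ, sq]
        exact Ideal.mul_mem_mul (Ideal.mul_mem_mul (hX _) (hX _)) (hX _)
    have hle : mm * I ^ 2 ≤ idealOfVars (Fin 3) k ^ 7 := by
      refine (Ideal.mul_mono hmm (Ideal.pow_right_mono hI3 2)).trans_eq ?_
      rw [← pow_mul, ← pow_succ']
    have h7 := (mem_pow_idealOfVars_iff _ _).1 (hle h)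
      (Finsupp.single 0 2 + Finsupp.single 1 2 + Finsupp.single 2 2) (by simp [hmono])
    simp at h7
  exact ⟨hI', hsymb, hmem, hnot, fun hle => hnot (hle hmem)⟩
end

section
/- Let R = k[x_0,…,x_n] be a polynomial ring over a field k, let I ⊆ R be a monomial ideal, and let 𝒬 be the symbolic polyhedron of I. Then α(𝒬) equals the Waldschmidt constant of I, i.e., the sequence α(I^{(m)})/m converges as m → ∞ and lim_{m→∞} α(I^{(m)})/m = α(𝒬). -/
open MvPolynomial Pointwise

/-- Membership in `R ∩ I ^ m R_P`, expressed without localization. -/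
lemma mem_contractedPower {R : Type*} [CommRing R] {I : Ideal R} {m : ℕ} {P : Ideal R}
    {hP : P.IsPrime} {f : R} : f ∈ contractedPower I m P hP ↔ ∃ s ∉ P, s * f ∈ I ^ m := by
  have := hP
  unfold contractedPower
  rw [Ideal.mem_comap, IsLocalization.algebraMap_mem_map_algebraMap_iff P.primeCompl]
  rfl

lemma contractedPower_one {R : Type*} [CommRing R] (I P : Ideal R) (hP : P.IsPrime) :
    contractedPower I 1 P hP = Qsub I P hP := by
  simp [contractedPower, Qsub]

lemma mem_Qsub {R : Type*} [CommRing R] {I P : Ideal R} {hP : P.IsPrime} {f : R} :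
    f ∈ Qsub I P hP ↔ ∃ s ∉ P, s * f ∈ I := by
  rw [← contractedPower_one, mem_contractedPower, pow_one]

lemma contractedPower_anti {R : Type*} [CommRing R] {I : Ideal R} {m : ℕ} {P P' : Ideal R}
    {hP : P.IsPrime} {hP' : P'.IsPrime} (h : P ≤ P') :
    contractedPower I m P' hP' ≤ contractedPower I m P hP := by
  intro f hf
  obtain ⟨s, hs, hsf⟩ := mem_contractedPower.1 hf
  exact mem_contractedPower.2 ⟨s, fun h' => hs (h h'), hsf⟩

lemma Qsub_pow_le {R : Type*} [CommRing R] (I P : Ideal R) (hP : P.IsPrime) (m : ℕ) :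
    Qsub I P hP ^ m ≤ contractedPower I m P hP := by
  have := hP
  unfold contractedPower Qsub
  rw [Ideal.map_pow]
  exact Ideal.le_comap_pow _ _

/-- A polynomial outside a prime has a monomial involving no variable of that prime. -/
lemma exists_mem_support_of_notMem {k σ : Type*} [Field k] {P : Ideal (MvPolynomial σ k)}
    {s : MvPolynomial σ k} (hs : s ∉ P) :
    ∃ c ∈ s.support, ∀ i, X i ∈ P → c i = 0 := by
  by_contra! h
  apply hs
  rw [s.as_sum]
  refine Ideal.sum_mem _ fun c hc => ?_
  obtain ⟨i, hi, hci⟩ := h c hc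
  refine Ideal.mem_of_dvd _ ?_ hi
  rw [X_dvd_monomial]
  exact Or.inr hci

lemma monomial_notMem {k σ : Type*} [Field k] {P : Ideal (MvPolynomial σ k)}
    (hP : P.IsPrime) {b : σ →₀ ℕ} (hb : ∀ i, X i ∈ P → b i = 0) :
    monomial b (1 : k) ∉ P := by
  intro h
  rw [monomial_eq, C_1, one_mul, Finsupp.prod] at h
  obtain ⟨i, hi, hib⟩ := (Ideal.IsPrime.prod_mem_iff (hp := hP)).1 h
  exact (Finsupp.mem_support_iff.1 hi) (hb i (hP.mem_of_pow_mem _ hib))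

/-- Colons of a monomial ideal by a polynomial with a monomial avoiding the variables in `U`
are, termwise, witnessed by monomials avoiding these variables. -/
lemma exists_le_add_of_mul_mem_span {k σ : Type*} [Field k] [Fintype σ] [LinearOrder σ]
    {T : Set (σ →₀ ℕ)} (U : Set σ) {s f : MvPolynomial σ k}
    (hs : ∃ c ∈ s.support, ∀ i ∈ U, c i = 0)
    (h : s * f ∈ Ideal.span ((fun a => monomial a (1 : k)) '' T)) :
    ∀ a ∈ f.support, ∃ b : σ →₀ ℕ, (∀ i ∈ U, b i = 0) ∧ ∃ t ∈ T, t ≤ a + b := by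
  classical
  by_contra! hbad
  let d : (σ →₀ ℕ) → ℕ := fun a => ∑ i with i ∈ U, a i
  let w : (σ →₀ ℕ) → ℕ ×ₗ Lex (σ →₀ ℕ) := fun a => toLex (d a, toLex a)
  have hw : ∀ a b, w (a + b) = w a + w b := fun a b => by
    have : d (a + b) = d a + d b := by simp [d, Finset.sum_add_distrib]
    simp only [w, this]
    rfl
  have hwi : Function.Injective w := fun a b hab => by
    have := congrArg (fun x => ofLex (ofLex x).2) hab
    exact this
  let bad : (σ →₀ ℕ) → Prop := fun a => ∀ b : σ →₀ ℕ, (∀ i ∈ U, b i = 0) → ∀ t ∈ T, ¬ t ≤ a + b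
  obtain ⟨a', ha', hbad'⟩ := hbad
  obtain ⟨a₀, ha₀, hmin⟩ := (f.support.filter bad).exists_min_image w
    ⟨a', Finset.mem_filter.2 ⟨ha', hbad'⟩⟩
  obtain ⟨c', hc', hc'U⟩ := hs
  obtain ⟨c₀, hc₀, hcmin⟩ := s.support.exists_min_image w ⟨c', hc'⟩
  have hc₀U : ∀ i ∈ U, c₀ i = 0 := by
    have h1 : d c₀ ≤ d c' := Prod.Lex.monotone_fst _ _ (hcmin c' hc')
    have h2 : d c' = 0 := Finset.sum_eq_zero fun i hi => hc'U i (Finset.mem_filter.1 hi).2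
    have h3 : d c₀ = 0 := by omega
    intro i hi
    exact Finset.sum_eq_zero_iff.1 h3 i (by simpa using hi)
  rw [Finset.mem_filter] at ha₀
  have hcoeff : coeff (c₀ + a₀) (s * f) = coeff c₀ s * coeff a₀ f := by
    rw [coeff_mul]
    refine Finset.sum_eq_single (c₀, a₀) ?_ (by simp)
    rintro ⟨c, a⟩ hca hne
    rw [Finset.HasAntidiagonal.mem_antidiagonal] at hca
    simp only at hca ⊢
    by_contra hz
    have hc : c ∈ s.support := mem_support_iff.2 (left_ne_zero_of_mul hz)
    have ha : a ∈ f.support := mem_support_iff.2 (right_ne_zero_of_mul hz)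
    by_cases hab : bad a
    · have h1 := hmin a (Finset.mem_filter.2 ⟨ha, hab⟩)
      have h2 := hcmin c hc
      have h3 : w c + w a = w c₀ + w a₀ := by rw [← hw, ← hw, hca]
      have h4 : w c = w c₀ := by
        by_contra hne'
        exact absurd h3 (add_lt_add_of_lt_of_le (lt_of_le_of_ne h2 (Ne.symm hne')) h1).ne'
      have h5 := hwi h4
      subst h5
      exact hne (by rw [add_left_cancel hca])
    · simp only [bad] at hab
      push Not at hab
      obtain ⟨b, hb, t, ht, hle⟩ := hab
      refine ha₀.2 (c₀ + b) (fun i hi => by simp [hc₀U i hi, hb i hi]) t ht (hle.trans ?_)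
      have : a₀ + (c₀ + b) = c + (a + b) := by
        rw [← add_assoc, add_comm a₀, ← hca, add_assoc]
      rw [this]
      exact le_add_of_nonneg_left zero_le
  have hne : c₀ + a₀ ∈ (s * f).support := by
    rw [mem_support_iff, hcoeff]
    exact mul_ne_zero (mem_support_iff.1 hc₀) (mem_support_iff.1 ha₀.1)
  obtain ⟨t, ht, hle⟩ := mem_ideal_span_monomial_image.1 h _ hne
  exact ha₀.2 c₀ hc₀U t ht (by rwa [add_comm])

/-- Powers of a monomial ideal are generated by the sums of exponents of generators. -/
lemma span_monomial_pow {k σ : Type*} [Field k] (S : Set (σ →₀ ℕ)) (m : ℕ) :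
    Ideal.span ((fun a => monomial a (1 : k)) '' S) ^ m =
      Ideal.span ((fun a => monomial a (1 : k)) ''
        {t | ∃ g : Fin m → (σ →₀ ℕ), (∀ j, g j ∈ S) ∧ t = ∑ j, g j}) := by
  induction m with
  | zero => simp
  | succ m ih =>
    rw [pow_succ, ih, Ideal.span_mul_span']
    congr 1
    ext p
    rw [Set.mem_mul]
    constructor
    · rintro ⟨_, ⟨_, ⟨g, hg, rfl⟩, rfl⟩, _, ⟨a, ha, rfl⟩, rfl⟩
      refine ⟨_, ⟨Fin.snoc g a, ?_, rfl⟩, ?_⟩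
      · intro j
        refine Fin.lastCases ?_ (fun j => ?_) j
        · simpa using ha
        · simpa using hg j
      · simp [Fin.sum_univ_castSucc, monomial_mul]
    · rintro ⟨_, ⟨g, hg, rfl⟩, rfl⟩
      refine ⟨_, ⟨_, ⟨fun j => g j.castSucc, fun j => hg _, rfl⟩, rfl⟩, _,
        ⟨_, hg (Fin.last m), rfl⟩, ?_⟩
      simp [Fin.sum_univ_castSucc, monomial_mul]

lemma latticePoints_mono {k : Type*} [Field k] {n : ℕ}
    {J J' : Ideal (MvPolynomial (Fin (n + 1)) k)} (h : J ≤ J') :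
    latticePoints J ⊆ latticePoints J' := by
  rintro _ ⟨a, ha, rfl⟩
  exact ⟨a, h ha, rfl⟩

lemma monomial_mem_of_le {k σ : Type*} [Field k] {J : Ideal (MvPolynomial σ k)}
    {a b : σ →₀ ℕ} (h : a ≤ b) (ha : monomial a (1 : k) ∈ J) : monomial b (1 : k) ∈ J :=
  J.mem_of_dvd (monomial_dvd_monomial.2 ⟨Or.inr h, dvd_rfl⟩) ha

/-- Exponents of elements of `R ∩ I ^ m R_P`, scaled by `1 / m`, lie in `conv (L(Q_{⊆ P}))`. -/
lemma inv_smul_expVec_mem_convexHull {k : Type*} [Field k] {n : ℕ}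
    {I : Ideal (MvPolynomial (Fin (n + 1)) k)} (hmon : IsMonomialIdeal I)
    {P : Ideal (MvPolynomial (Fin (n + 1)) k)} (hP : P.IsPrime) {m : ℕ} (hm : 0 < m)
    {f : MvPolynomial (Fin (n + 1)) k} (hf : f ∈ contractedPower I m P hP)
    {a : Fin (n + 1) →₀ ℕ} (ha : a ∈ f.support) :
    (m : ℝ)⁻¹ • expVec a ∈ convexHull ℝ (latticePoints (Qsub I P hP)) := by
  classical
  obtain ⟨S, rfl⟩ := hmon
  obtain ⟨s, hs, hsf⟩ := mem_contractedPower.1 hf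
  rw [span_monomial_pow] at hsf
  obtain ⟨b, hb, _, ⟨g, hg, rfl⟩, hle⟩ := exists_le_add_of_mul_mem_span {i | X i ∈ P}
    (exists_mem_support_of_notMem hs) hsf a ha
  let g' : Fin m → (Fin (n + 1) →₀ ℕ) := fun j => (g j).filter fun i => X i ∈ P
  have hg' : ∀ j, monomial (g' j) (1 : k) ∈
      Qsub (Ideal.span ((fun a => monomial a (1 : k)) '' S)) P hP := fun j => by
    refine mem_Qsub.2 ⟨monomial ((g j).filter fun i => ¬ X i ∈ P) 1,
      monomial_notMem hP fun i hi => by simp [hi], ?_⟩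
    rw [monomial_mul, add_comm (Finsupp.filter _ _) (g' j), Finsupp.filter_add_filter_not, one_mul]
    exact Ideal.subset_span ⟨_, hg j, rfl⟩
  have hle' : ∑ j, g' j ≤ a := fun i => by
    by_cases hi : X i ∈ P
    · have := hle i
      simp only [Finsupp.coe_finsetSum, Finset.sum_apply, Finsupp.add_apply, hb i hi,
        add_zero] at this
      simpa [g', hi, Finsupp.finsetSum_apply] using this
    · simp [g', hi, Finsupp.finsetSum_apply]
  obtain ⟨c, hc⟩ := exists_add_of_le hle'
  let j₀ : Fin m := ⟨0, hm⟩
  let z : Fin m → (Fin (n + 1) →₀ ℕ) := fun j => g' j + if j = j₀ then c else 0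
  have hz : ∑ j, z j = a := by simp [z, Finset.sum_add_distrib, hc]
  have hsum : (m : ℝ)⁻¹ • expVec a = ∑ j, (m : ℝ)⁻¹ • expVec (z j) := by
    rw [← Finset.smul_sum, ← hz]
    congr 1
    ext i
    simp [expVec, Finsupp.finsetSum_apply]
  rw [hsum]
  refine (convex_convexHull ℝ _).sum_mem (fun _ _ => by positivity) ?_ fun j _ => ?_
  · simp [hm.ne']
  · exact subset_convexHull ℝ _ ⟨z j, monomial_mem_of_le le_self_add (hg' j), rfl⟩

/-- Lattice points lying deep enough in `m • conv (L(Q_{⊆ P}))` are exponents of monomials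
of `R ∩ I ^ m R_P`. -/
lemma exists_forall_monomial_mem_contractedPower {k : Type*} [Field k] {n : ℕ}
    {I P : Ideal (MvPolynomial (Fin (n + 1)) k)} (hP : P.IsPrime) {v : Fin (n + 1) → ℝ}
    (hv : v ∈ convexHull ℝ (latticePoints (Qsub I P hP))) :
    ∃ C : Fin (n + 1) →₀ ℕ, ∀ (m : ℕ) (a : Fin (n + 1) →₀ ℕ),
      (∀ i, m * v i + C i ≤ a i) → monomial a (1 : k) ∈ contractedPower I m P hP := by
  obtain ⟨ι, _, w, z, hw, hw1, hz, rfl⟩ := mem_convexHull_iff_exists_fintype.1 hv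
  choose e he hze using hz
  refine ⟨∑ j, e j, fun m a ha => ?_⟩
  let q : ι → ℕ := fun j => ⌈m * w j⌉₊
  have hle : ∑ j, q j • e j ≤ a := fun i => by
    have h1 := ha i
    rw [← Nat.cast_le (α := ℝ)]
    refine le_trans ?_ h1
    simp only [Finsupp.finsetSum_apply, Finset.sum_apply, Pi.smul_apply, smul_eq_mul,
      Finsupp.smul_apply, Nat.cast_sum, Nat.cast_mul, Finset.mul_sum, ← Finset.sum_add_distrib]
    refine Finset.sum_le_sum fun j _ => ?_
    have h2 : (q j : ℝ) ≤ m * w j + 1 := (Nat.ceil_lt_add_one (by have := hw j; positivity)).le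
    have h3 : z j i = e j i := by rw [hze j]; rfl
    rw [h3]
    nlinarith [(Nat.cast_nonneg (e j i) : (0 : ℝ) ≤ e j i)]
  have hq : m ≤ ∑ j, q j := by
    have : (m : ℝ) ≤ ∑ j, (q j : ℝ) := by
      calc (m : ℝ) = ∑ j, m * w j := by rw [← Finset.mul_sum, hw1, mul_one]
        _ ≤ _ := Finset.sum_le_sum fun j _ => Nat.le_ceil _
    exact_mod_cast this
  refine monomial_mem_of_le hle (Qsub_pow_le I P hP m (Ideal.pow_le_pow_right hq ?_))
  have : monomial (∑ j, q j • e j) (1 : k) = ∏ j, monomial (e j) (1 : k) ^ q j := by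
    simp [monomial_pow, monomial_sum_one]
  rw [this, ← Finset.prod_pow_eq_pow_sum]
  exact Ideal.prod_mem_prod fun j _ => Ideal.pow_mem_pow (he j) _

lemma exists_maxAss_ge {R : Type*} [CommRing R] [IsNoetherianRing R] {I P : Ideal R}
    (hP : P ∈ associatedPrimes R (R ⧸ I)) : ∃ P' ∈ maxAss I, P ≤ P' := by
  obtain ⟨P', hle, hmax⟩ := (associatedPrimes.finite R (R ⧸ I)).exists_le_maximal hP
  exact ⟨P', ⟨hmax.1, fun Q hQ h => le_antisymm h (hmax.2 hQ h)⟩, hle⟩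

lemma exists_monomial_mem {k : Type*} [Field k] {n : ℕ}
    {I : Ideal (MvPolynomial (Fin (n + 1)) k)} (hmon : IsMonomialIdeal I) (hI : I ≠ ⊥) :
    ∃ a : Fin (n + 1) →₀ ℕ, monomial a (1 : k) ∈ I := by
  obtain ⟨S, rfl⟩ := hmon
  obtain rfl | ⟨a, ha⟩ := S.eq_empty_or_nonempty
  · simp at hI
  · exact ⟨a, Ideal.subset_span ⟨a, ha, rfl⟩⟩

lemma symbolicPolyhedron_nonempty {k : Type*} [Field k] {n : ℕ}
    {I : Ideal (MvPolynomial (Fin (n + 1)) k)} (hmon : IsMonomialIdeal I) (hI : I ≠ ⊥) :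
    (symbolicPolyhedron I).Nonempty := by
  obtain ⟨a, ha⟩ := exists_monomial_mem hmon hI
  refine ⟨expVec a, Set.mem_iInter.2 fun P => subset_convexHull ℝ _ ⟨a, ?_, rfl⟩⟩
  exact mem_Qsub.2 ⟨1, P.2.1.isPrime.one_notMem, by simpa using ha⟩

lemma nonneg_of_mem_symbolicPolyhedron {k : Type*} [Field k] {n : ℕ}
    {I : Ideal (MvPolynomial (Fin (n + 1)) k)} (hne : (maxAss I).Nonempty)
    {v : Fin (n + 1) → ℝ} (hv : v ∈ symbolicPolyhedron I) (i : Fin (n + 1)) : 0 ≤ v i := by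
  obtain ⟨P, hP⟩ := hne
  have h1 := Set.mem_iInter.1 hv ⟨P, hP⟩
  have h2 : latticePoints (Qsub I P hP.1.isPrime) ⊆ Set.Ici 0 := by
    rintro _ ⟨a, -, rfl⟩ i
    exact Nat.cast_nonneg _
  exact convexHull_min h2 (convex_Ici 0) h1 i

lemma mul_alphaSet_le_alphaI {k : Type*} [Field k] {n : ℕ}
    {I : Ideal (MvPolynomial (Fin (n + 1)) k)} (hmon : IsMonomialIdeal I) (hI : I ≠ ⊥)
    (hne : (maxAss I).Nonempty) {m : ℕ} (hm : 0 < m) :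
    alphaSet (symbolicPolyhedron I) ≤ (alphaI (symbolicPower I m) : ℝ) / m := by
  obtain ⟨a₀, ha₀⟩ := exists_monomial_mem hmon hI
  have hnonempty : {d | ∃ f ∈ symbolicPower I m, f ≠ 0 ∧ f.IsHomogeneous d}.Nonempty := by
    refine ⟨_, monomial a₀ (1 : k) ^ m, Ideal.mem_iInf.2 fun P => ?_, ?_,
      (isHomogeneous_monomial _ rfl).pow m⟩
    · exact mem_contractedPower.2 ⟨1, P.2.isPrime.one_notMem, by
        simpa using Ideal.pow_mem_pow ha₀ m⟩
    · exact pow_ne_zero _ (by simp)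
  obtain ⟨f, hf, hf0, hfd⟩ := Nat.sInf_mem hnonempty
  obtain ⟨a, ha⟩ := support_nonempty.2 hf0
  have hdeg : ∑ i, a i = alphaI (symbolicPower I m) := by
    have := hfd (mem_support_iff.1 ha)
    rwa [Pi.one_def, ← Finsupp.degree_eq_weight_one, Finsupp.degree_eq_sum] at this
  rw [← hdeg]
  refine csInf_le ⟨0, ?_⟩ ⟨(m : ℝ)⁻¹ • expVec a, Set.mem_iInter.2 fun P => ?_, ?_⟩
  · rintro _ ⟨v, hv, rfl⟩
    exact Finset.sum_nonneg fun i _ => nonneg_of_mem_symbolicPolyhedron hne hv i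
  · exact inv_smul_expVec_mem_convexHull hmon _ hm (Ideal.mem_iInf.1 hf ⟨P.1, P.2.1⟩) ha
  · simp [expVec, ← Finset.mul_sum, div_eq_inv_mul]

lemma exists_alphaI_le {k : Type*} [Field k] {n : ℕ}
    {I : Ideal (MvPolynomial (Fin (n + 1)) k)} (hne : (maxAss I).Nonempty)
    {v : Fin (n + 1) → ℝ} (hv : v ∈ symbolicPolyhedron I) :
    ∃ K : ℝ, ∀ m : ℕ, (alphaI (symbolicPower I m) : ℝ) ≤ m * ∑ i, v i + K := by
  have hv0 := nonneg_of_mem_symbolicPolyhedron hne hv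
  have hfin : Finite {P // P ∈ maxAss I} :=
    ((associatedPrimes.finite _ (_ ⧸ I)).subset fun _ h => h.1).to_subtype
  cases nonempty_fintype {P // P ∈ maxAss I}
  choose C hC using fun P : {P // P ∈ maxAss I} =>
    exists_forall_monomial_mem_contractedPower P.2.1.isPrime (Set.mem_iInter.1 hv P)
  refine ⟨∑ i, ((∑ P, C P) i + 1 : ℝ), fun m => ?_⟩
  let a : Fin (n + 1) →₀ ℕ := Finsupp.equivFunOnFinite.symm (fun i => ⌈m * v i⌉₊) + ∑ P, C P
  have ha : ∀ i, a i = ⌈m * v i⌉₊ + (∑ P, C P) i := fun i => rfl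
  have hmem : monomial a (1 : k) ∈ symbolicPower I m := by
    refine Ideal.mem_iInf.2 fun P => ?_
    obtain ⟨P', hP', hle⟩ := exists_maxAss_ge P.2
    refine contractedPower_anti hle (hC ⟨P', hP'⟩ m a fun i => ?_)
    rw [ha, Nat.cast_add]
    refine add_le_add (Nat.le_ceil _) (Nat.cast_le.2 ?_)
    exact Finset.single_le_sum (f := C) (fun _ _ => zero_le) (Finset.mem_univ _) i
  have hle : alphaI (symbolicPower I m) ≤ ∑ i, a i :=
    Nat.sInf_le ⟨_, hmem, by simp, isHomogeneous_monomial _ (Finsupp.degree_eq_sum a)⟩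
  calc (alphaI (symbolicPower I m) : ℝ) ≤ ∑ i, (a i : ℝ) := by exact_mod_cast hle
    _ ≤ ∑ i, (m * v i + ((∑ P, C P) i + 1)) := by
      refine Finset.sum_le_sum fun i _ => ?_
      have := (Nat.ceil_lt_add_one (mul_nonneg (Nat.cast_nonneg m) (hv0 i))).le
      rw [ha, Nat.cast_add]
      linarith
    _ = _ := by rw [Finset.sum_add_distrib, Finset.mul_sum]

lemma maxAss_nonempty {R : Type*} [CommRing R] [IsNoetherianRing R] {I : Ideal R}
    (h : I ≠ ⊤) : (maxAss I).Nonempty := by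
  have := Ideal.Quotient.nontrivial_iff.2 h
  obtain ⟨P, hP⟩ := associatedPrimes.nonempty R (R ⧸ I)
  obtain ⟨P', hP', -⟩ := exists_maxAss_ge hP
  exact ⟨P', hP'⟩

lemma alphaI_top {k : Type*} [Field k] {n : ℕ} :
    alphaI (⊤ : Ideal (MvPolynomial (Fin (n + 1)) k)) = 0 :=
  Nat.sInf_eq_zero.2 (Or.inl ⟨1, trivial, one_ne_zero, isHomogeneous_one _ _⟩)

lemma alphaSet_univ {n : ℕ} : alphaSet (Set.univ : Set (Fin (n + 1) → ℝ)) = 0 := by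
  refine Real.sInf_of_not_bddBelow fun ⟨b, hb⟩ => ?_
  have := hb ⟨Pi.single 0 (b - 1), trivial, rfl⟩
  simp at this
  linarith

theorem alpha_symbolic_polyhedron_eq_waldschmidt {k : Type*} [Field k] {n : ℕ}
    (I : Ideal (MvPolynomial (Fin (n + 1)) k)) (hmon : IsMonomialIdeal I) (hI : I ≠ ⊥) :
    Filter.Tendsto (fun m : ℕ => (alphaI (symbolicPower I m) : ℝ) / (m : ℝ))
      Filter.atTop (nhds (alphaSet (symbolicPolyhedron I))) := by
  by_cases htop : I = ⊤
  · subst htop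
    have hempty : IsEmpty {P // P ∈ associatedPrimes (MvPolynomial (Fin (n + 1)) k)
        (MvPolynomial (Fin (n + 1)) k ⧸ (⊤ : Ideal (MvPolynomial (Fin (n + 1)) k)))} :=
      ⟨fun P => by simpa [associatedPrimes.eq_empty_of_subsingleton] using P.2⟩
    have hempty' : IsEmpty {P // P ∈ maxAss (⊤ : Ideal (MvPolynomial (Fin (n + 1)) k))} :=
      ⟨fun P => hempty.false ⟨P.1, P.2.1⟩⟩
    have h1 : symbolicPolyhedron (⊤ : Ideal (MvPolynomial (Fin (n + 1)) k)) = Set.univ :=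
      Set.iInter_of_empty _
    have h2 : ∀ m, symbolicPower (⊤ : Ideal (MvPolynomial (Fin (n + 1)) k)) m = ⊤ :=
      fun m => iInf_of_empty _
    simp [h1, h2, alphaI_top, alphaSet_univ]
  have hne := maxAss_nonempty htop
  refine tendsto_order.2 ⟨fun b hb => ?_, fun b hb => ?_⟩
  · filter_upwards [Filter.eventually_gt_atTop 0] with m hm
    exact hb.trans_le (mul_alphaSet_le_alphaI hmon hI hne hm)
  · obtain ⟨_, ⟨v, hv, rfl⟩, hvb⟩ := exists_lt_of_csInf_lt
      ((symbolicPolyhedron_nonempty hmon hI).image _) hb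
    obtain ⟨K, hK⟩ := exists_alphaI_le hne hv
    have hlim : Filter.Tendsto (fun m : ℕ => ∑ i, v i + K / (m : ℝ)) Filter.atTop
        (nhds (∑ i, v i)) := by
      simpa using (tendsto_const_div_atTop_nhds_zero_nat K).const_add (∑ i, v i)
    filter_upwards [hlim.eventually_lt_const hvb, Filter.eventually_gt_atTop 0] with m hm hm0
    refine lt_of_le_of_lt ?_ hm
    have hm' : (0 : ℝ) < m := Nat.cast_pos.2 hm0
    rw [div_le_iff₀ hm', add_mul, div_mul_cancel₀ _ hm'.ne', mul_comm (∑ i, v i)]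
    exact hK m
end
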